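/- For every m ≥ 1, the operator R := Σ_j y_j∂_{x_j} + (1/2)(multiplication by Σ_j z_j²) commutes with both the symplectic Dirac operator and its adjoint: [R, D_s] = 0 and [R, X_s] = 0. -/

import Mathlib

open MvPolynomial Finset

noncomputable section

/-- Polynomials in 3m variables x_1..x_m, y_1..y_m, z_1..z_m. -/
abbrev PS (m : ℕ) : Type := MvPolynomial (Fin m ⊕ Fin m ⊕ Fin m) ℂ

variable (m : ℕ)

/-- partial derivative ∂_{x_j} -/
def dx (j : Fin m) : Module.End ℂ (PS m) := (pderiv (Sum.inl j)).toLinearMap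
/-- partial derivative ∂_{y_j} -/
def dy (j : Fin m) : Module.End ℂ (PS m) := (pderiv (Sum.inr (Sum.inl j))).toLinearMap
/-- partial derivative ∂_{z_j} -/
def dz (j : Fin m) : Module.End ℂ (PS m) := (pderiv (Sum.inr (Sum.inr j))).toLinearMap
/-- multiplication by x_j -/
def mx (j : Fin m) : Module.End ℂ (PS m) := LinearMap.mulLeft ℂ (X (Sum.inl j))
/-- multiplication by y_j -/
def my (j : Fin m) : Module.End ℂ (PS m) := LinearMap.mulLeft ℂ (X (Sum.inr (Sum.inl j)))
/-- multiplication by z_j -/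
def mz (j : Fin m) : Module.End ℂ (PS m) := LinearMap.mulLeft ℂ (X (Sum.inr (Sum.inr j)))

/-- symplectic Dirac operator D_s = ⟨z,∂_y⟩ − ⟨∂_z,∂_x⟩ -/
def Ds : Module.End ℂ (PS m) := (∑ j, mz m j * dy m j) - ∑ j, dz m j * dx m j
/-- adjoint X_s = ⟨y,∂_z⟩ + ⟨x,z⟩ -/
def Xs : Module.End ℂ (PS m) := (∑ j, my m j * dz m j) + ∑ j, mx m j * mz m j
/-- Euler operator in x -/
def Ex : Module.End ℂ (PS m) := ∑ j, mx m j * dx m j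
/-- Euler operator in y -/
def Ey : Module.End ℂ (PS m) := ∑ j, my m j * dy m j
/-- Euler operator in z -/
def Ez : Module.End ℂ (PS m) := ∑ j, mz m j * dz m j
/-- Δ_x -/
def lapX : Module.End ℂ (PS m) := ∑ j, dx m j * dx m j
/-- Δ_y -/
def lapY : Module.End ℂ (PS m) := ∑ j, dy m j * dy m j
/-- Δ_z -/
def lapZ : Module.End ℂ (PS m) := ∑ j, dz m j * dz m j
/-- ⟨∂_x,∂_y⟩ -/
def dxdy : Module.End ℂ (PS m) := ∑ j, dx m j * dy m j
/-- ⟨∂_y,∂_z⟩ -/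
def dydz : Module.End ℂ (PS m) := ∑ j, dy m j * dz m j
/-- ⟨∂_x,∂_z⟩ = ⟨∂_z,∂_x⟩ -/
def dxdz : Module.End ℂ (PS m) := ∑ j, dx m j * dz m j
/-- ⟨x,∂_y⟩ -/
def xdy : Module.End ℂ (PS m) := ∑ j, mx m j * dy m j
/-- ⟨y,∂_x⟩ -/
def ydx : Module.End ℂ (PS m) := ∑ j, my m j * dx m j
/-- ⟨x,∂_z⟩ -/
def xdz : Module.End ℂ (PS m) := ∑ j, mx m j * dz m j
/-- ⟨z,∂_x⟩ -/
def zdx : Module.End ℂ (PS m) := ∑ j, mz m j * dx m j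
/-- ⟨y,∂_z⟩ -/
def ydz : Module.End ℂ (PS m) := ∑ j, my m j * dz m j
/-- ⟨z,∂_y⟩ -/
def zdy : Module.End ℂ (PS m) := ∑ j, mz m j * dy m j
/-- multiplication by |x|² -/
def nx2 : Module.End ℂ (PS m) := ∑ j, mx m j * mx m j
/-- multiplication by |y|² -/
def ny2 : Module.End ℂ (PS m) := ∑ j, my m j * my m j
/-- multiplication by |z|² -/
def nz2 : Module.End ℂ (PS m) := ∑ j, mz m j * mz m j
/-- multiplication by ⟨x,y⟩ -/
def mxy : Module.End ℂ (PS m) := ∑ j, mx m j * my m j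
/-- multiplication by ⟨y,z⟩ -/
def myz : Module.End ℂ (PS m) := ∑ j, my m j * mz m j
/-- multiplication by ⟨x,z⟩ -/
def mxz : Module.End ℂ (PS m) := ∑ j, mx m j * mz m j
/-- L = ⟨x,∂_y⟩ − (1/2)Δ_z -/
def Lop : Module.End ℂ (PS m) := xdy m - (1/2 : ℂ) • lapZ m
/-- R = ⟨y,∂_x⟩ + (1/2)|z|² -/
def Rop : Module.End ℂ (PS m) := ydx m + (1/2 : ℂ) • nz2 m

/-- Partial derivatives of multivariate polynomials commute. -/
theorem pderiv_pderiv_comm {σ : Type*} (a b : σ) (p : MvPolynomial σ ℂ) :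
    pderiv a (pderiv b p) = pderiv b (pderiv a p) := by
  classical
  have h : ⁅pderiv (R := ℂ) a, pderiv (R := ℂ) b⁆ = 0 := by
    refine MvPolynomial.derivation_ext fun i => ?_
    simp [Derivation.commutator_apply, pderiv_X, Pi.single_apply, apply_ite]
  have := congrArg (fun D => D p) h
  simpa [Derivation.commutator_apply, sub_eq_zero] using this

theorem Rop_apply (p : PS m) :
    Rop m p = (∑ i, X (Sum.inr (Sum.inl i)) * pderiv (Sum.inl i) p) +
      (1 / 2 : ℂ) • ((∑ i, X (Sum.inr (Sum.inr i)) * X (Sum.inr (Sum.inr i))) * p) := by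
  simp [Rop, ydx, nz2, my, dx, mz, sum_mul, mul_assoc]

/-- Leibniz rule for the ring commutator applied to a finite sum of products. -/
theorem Ring.lie_sum_mul {A ι : Type*} [Ring A] (s : Finset ι) (r : A) (a b : ι → A) :
    ⁅r, ∑ j ∈ s, a j * b j⁆ = ∑ j ∈ s, (⁅r, a j⁆ * b j + a j * ⁅r, b j⁆) := by
  simp only [Ring.lie_def, mul_sum, sum_mul, ← sum_sub_distrib]
  exact sum_congr rfl fun j _ => by noncomm_ring

theorem Ring.commutator_neg {A : Type*} [Ring A] (r a : A) : ⁅r, -a⁆ = -⁅r, a⁆ := by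
  simp [Ring.lie_def, sub_eq_add_neg, add_comm]

/-- A quadratic element `∑ a b + ∑ c d` is annihilated by `⁅r, ·⁆` when `⁅r, ·⁆` kills `a` and `d`,
and maps `b` to `-d` and `c` to `a`. -/
theorem Ring.lie_sum_mul_add_sum_mul_eq_zero {A ι : Type*} [Ring A] (s : Finset ι) (r : A)
    {a b c d : ι → A} (ha : ∀ j, ⁅r, a j⁆ = 0) (hb : ∀ j, ⁅r, b j⁆ = -d j)
    (hc : ∀ j, ⁅r, c j⁆ = a j) (hd : ∀ j, ⁅r, d j⁆ = 0) :
    ⁅r, ∑ j ∈ s, a j * b j + ∑ j ∈ s, c j * d j⁆ = 0 := by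
  have h (u v : A) : ⁅r, u + v⁆ = ⁅r, u⁆ + ⁅r, v⁆ := by
    simp only [Ring.lie_def]; noncomm_ring
  rw [h, Ring.lie_sum_mul, Ring.lie_sum_mul]
  simp [ha, hb, hc, hd]

theorem lie_Rop_mx (j : Fin m) : ⁅Rop m, mx m j⁆ = my m j := by
  refine LinearMap.ext fun p => ?_
  simp [Ring.lie_def, Rop_apply, mx, my, pderiv_X, Pi.single_apply, mul_add, sum_add_distrib,
    mul_sum, mul_left_comm]

theorem lie_Rop_my (j : Fin m) : ⁅Rop m, my m j⁆ = 0 := by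
  refine LinearMap.ext fun p => ?_
  simp [Ring.lie_def, Rop_apply, my, pderiv_X, mul_add, mul_sum,
    mul_left_comm]

theorem lie_Rop_mz (j : Fin m) : ⁅Rop m, mz m j⁆ = 0 := by
  refine LinearMap.ext fun p => ?_
  simp [Ring.lie_def, Rop_apply, mz, pderiv_X, mul_add, mul_sum,
    mul_left_comm]

theorem lie_Rop_dx (j : Fin m) : ⁅Rop m, dx m j⁆ = 0 := by
  refine LinearMap.ext fun p => ?_
  simp [Ring.lie_def, Rop_apply, dx, pderiv_X,
    pderiv_pderiv_comm (Sum.inl j)]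

theorem lie_Rop_dy (j : Fin m) : ⁅Rop m, dy m j⁆ = -dx m j := by
  refine LinearMap.ext fun p => ?_
  simp [Ring.lie_def, Rop_apply, dx, dy, pderiv_X, Pi.single_apply, sum_add_distrib,
    pderiv_pderiv_comm (Sum.inr (Sum.inl j))]

theorem lie_Rop_dz (j : Fin m) : ⁅Rop m, dz m j⁆ = -mz m j := by
  refine LinearMap.ext fun p => ?_
  simp [Ring.lie_def, Rop_apply, dz, mz, pderiv_X, Pi.single_apply, sum_add_distrib,
    pderiv_pderiv_comm (Sum.inr (Sum.inr j))]
  rw [← two_smul ℂ (X _), mul_smul_comm, inv_smul_smul₀ two_ne_zero, mul_comm]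

/-- [R, D_s] = 0 and [R, X_s] = 0. -/
theorem stmt12 : ∀ m : ℕ, 1 ≤ m →
    ⁅Rop m, Ds m⁆ = 0 ∧ ⁅Rop m, Xs m⁆ = 0 := by
  intro m _
  constructor
  · have h : Ds m = ∑ j, mz m j * dy m j + ∑ j, (-dz m j) * dx m j :=
      LinearMap.ext fun p => by simp [Ds, sub_eq_add_neg]
    rw [h]
    refine Ring.lie_sum_mul_add_sum_mul_eq_zero _ _ (lie_Rop_mz m) (lie_Rop_dy m) (fun j => ?_)
      (lie_Rop_dx m)
    exact (Ring.commutator_neg _ _).trans (neg_eq_iff_eq_neg.mpr (lie_Rop_dz m j))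
  · exact Ring.lie_sum_mul_add_sum_mul_eq_zero _ _ (lie_Rop_my m) (lie_Rop_dz m) (lie_Rop_mx m)
      (lie_Rop_mz m)
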